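/- arXiv:1308.4429 — 3 statements merged into one kernel-verified Lean document; each statement's English description precedes it below -/
import Mathlib

section
/- Every closed subspace X of c₀ of finite codimension admits an Auerbach basis. -/
open ZeroAtInftyContinuousMap Filter
open scoped ZeroAtInfty

/-- The `k`-th standard unit vector `e_k` in `c₀` (indices starting at `0`). -/
noncomputable def e (k : ℕ) : C₀(ℕ, ℝ) where
  toFun := Pi.single k 1
  zero_at_infty' := by
    refine Filter.Tendsto.congr' ?_ tendsto_const_nhds
    have h : {k}ᶜ ∈ Filter.cocompact ℕ := by
      rw [Filter.cocompact_eq_cofinite]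
      simp [Filter.mem_cofinite]
    filter_upwards [h] with n hn
    simp only [Set.mem_compl_iff, Set.mem_singleton_iff] at hn
    simp [Pi.single_apply, hn]

/-- The `k`-th coordinate functional `e_k^*` on `c₀`. -/
noncomputable def coord (k : ℕ) : C₀(ℕ, ℝ) →L[ℝ] ℝ :=
  LinearMap.mkContinuous
    { toFun := fun y => y k
      map_add' := by intros; rfl
      map_smul' := by intros; rfl }
    1
    (fun y => by simpa using y.toBCF.norm_coe_le_norm k)

/-- The functional `f = ∑ₙ aₙ eₙ^* ∈ ℓ¹ = c₀^*` determined by a (summable) coefficient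
sequence `a`. -/
noncomputable def funcOf (a : ℕ → ℝ) : C₀(ℕ, ℝ) →L[ℝ] ℝ := ∑' n : ℕ, a n • coord n

/-- The vectors `xₙ = e_{n+1} - (a_{n+1}/a₀) • e₀` (here `a₀` plays the role of the
coefficient of maximal absolute value, i.e. the paper's `a₁`). -/
noncomputable def xvec (a : ℕ → ℝ) (n : ℕ) : C₀(ℕ, ℝ) :=
  e (n + 1) - (a (n + 1) / a 0) • e 0

/-- An Auerbach basis of a normed space: a biorthogonal system of norm-one vectors and
norm-one functionals which is fundamental (the closed linear span of the vectors is the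
whole space) and total (the functionals separate points). -/
structure IsAuerbachBasis {X : Type*} [NormedAddCommGroup X] [NormedSpace ℝ X]
    {ι : Type*} (x : ι → X) (f : ι → X →L[ℝ] ℝ) : Prop where
  biorth_eq : ∀ k, f k (x k) = 1
  biorth_ne : ∀ k j, k ≠ j → f k (x j) = 0
  norm_vec : ∀ n, ‖x n‖ = 1
  norm_fun : ∀ n, ‖f n‖ = 1
  fundamental : (Submodule.span ℝ (Set.range x)).topologicalClosure = ⊤
  total : ∀ y, (∀ n, f n y = 0) → y = 0

open Topology

/-- A spanning null sequence in a finite-dimensional space contains a basis with respect to which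
every term of the sequence has coordinates bounded by `1`. -/
theorem exists_basis_abs_repr_le_one {Q : Type*} [NormedAddCommGroup Q] [NormedSpace ℝ Q]
    [FiniteDimensional ℝ Q] (u : ℕ → Q) (hu : Tendsto u atTop (𝓝 0))
    (hspan : Submodule.span ℝ (Set.range u) = ⊤) :
    ∃ (κ : Type) (_ : Fintype κ) (c : Module.Basis κ ℝ Q) (v : κ → ℕ),
      (∀ i, c i = u (v i)) ∧ ∀ n i, |c.repr (u n) i| ≤ 1 := by
  classical
  obtain ⟨κ, a, -, hspan', hli⟩ := exists_linearIndependent' ℝ u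
  have : Fintype κ := @Fintype.ofFinite κ hli.finite
  let b := Module.Basis.mk hli (by rw [hspan', hspan])
  have hb : b.det (u ∘ a) = 1 := by
    rw [← Module.Basis.coe_mk hli (by rw [hspan', hspan])]
    exact b.det_self
  have hcont : Continuous fun w : κ → Q => |b.det w| := by
    refine continuous_abs.comp ?_
    change Continuous fun w : κ → Q => (b.toMatrix w).det
    refine Continuous.matrix_det (continuous_matrix fun i j => ?_)
    exact (b.coord i).continuous_of_finiteDimensional.comp (continuous_apply j)
  obtain ⟨w, hw, hmax⟩ := (isCompact_univ_pi fun _ : κ => hu.isCompact_insert_range).exists_isMaxOn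
    ⟨fun _ => 0, by simp⟩ hcont.continuousOn
  have hdet : 1 ≤ |b.det w| := by
    have h := hmax (show u ∘ a ∈ Set.univ.pi fun _ => insert 0 (Set.range u) by simp)
    simpa [hb] using h
  have hdet0 : b.det w ≠ 0 := fun h => by norm_num [h] at hdet
  have hv : ∀ i, ∃ n, u n = w i := fun i => by
    rcases hw i (Set.mem_univ i) with h | h
    · exact absurd (b.det.map_coord_zero i h) hdet0
    · exact h
  choose v hv using hv
  obtain ⟨hwli, hwspan⟩ := (b.is_basis_iff_det).2 (isUnit_iff_ne_zero.2 hdet0)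
  refine ⟨κ, inferInstance, Module.Basis.mk hwli hwspan.ge, v, fun i => by simp [hv], ?_⟩
  intro n i
  have hupd := hmax (show Function.update w i (u n) ∈ Set.univ.pi fun _ => insert 0 (Set.range u) by
    intro j _
    rcases eq_or_ne j i with rfl | hj
    · simp
    · simpa [hj] using hw j (Set.mem_univ j))
  have h := congrArg abs
    (LinearMap.congr_fun (b.det_smul_mk_coord_eq_det_update hwli hwspan.ge i) (u n))
  simp only [LinearMap.smul_apply, smul_eq_mul, abs_mul, MultilinearMap.toLinearMap_apply,
    Module.Basis.coord_apply] at h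
  have hle : |b.det w| * |(Module.Basis.mk hwli hwspan.ge).repr (u n) i| ≤ |b.det w| * 1 := by
    rw [h, mul_one]
    exact hupd
  exact le_of_mul_le_mul_left hle (by linarith)

@[simp]
theorem e_apply (k n : ℕ) : e k n = if n = k then 1 else 0 := by
  change (Pi.single k 1 : ℕ → ℝ) n = _
  simp [Pi.single_apply]

@[simp]
theorem coord_apply (k : ℕ) (y : C₀(ℕ, ℝ)) : coord k y = y k := rfl

theorem zeroAtInfty_sum_apply {ι : Type*} (s : Finset ι) (y : ι → C₀(ℕ, ℝ)) (n : ℕ) :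
    (∑ i ∈ s, y i) n = ∑ i ∈ s, y i n := by
  simp only [← coord_apply, map_sum]

theorem zeroAtInfty_norm_le {y : C₀(ℕ, ℝ)} {C : ℝ} (hC : 0 ≤ C) (h : ∀ n, |y n| ≤ C) :
    ‖y‖ ≤ C := by
  rw [← norm_toBCF_eq_norm]
  exact (BoundedContinuousFunction.norm_le hC).2 h

theorem abs_apply_le_norm (y : C₀(ℕ, ℝ)) (n : ℕ) : |y n| ≤ ‖y‖ :=
  y.toBCF.norm_coe_le_norm n

theorem sum_smul_e_apply (s : Finset ℕ) (a : ℕ → ℝ) (n : ℕ) :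
    (∑ k ∈ s, a k • e k) n = if n ∈ s then a n else 0 := by
  simp [zeroAtInfty_sum_apply]

/-- A bounded functional on `c₀` has an absolutely summable coefficient sequence. -/
theorem summable_abs_apply_e (f : C₀(ℕ, ℝ) →L[ℝ] ℝ) : Summable fun n => |f (e n)| := by
  refine summable_of_sum_le (c := ‖f‖) (fun n => abs_nonneg _) fun s => ?_
  have hnorm : ‖∑ n ∈ s, (SignType.sign (f (e n)) : ℝ) • e n‖ ≤ 1 := by
    refine zeroAtInfty_norm_le zero_le_one fun n => ?_
    rw [sum_smul_e_apply]
    split_ifs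
    · rcases lt_trichotomy (f (e n)) 0 with h | h | h <;> simp [h]
    · simp
  calc ∑ n ∈ s, |f (e n)| = f (∑ n ∈ s, (SignType.sign (f (e n)) : ℝ) • e n) := by
        simp [map_sum, sign_mul_self]
    _ ≤ ‖f (∑ n ∈ s, (SignType.sign (f (e n)) : ℝ) • e n)‖ := le_abs_self _
    _ ≤ ‖f‖ * 1 := f.le_opNorm_of_le hnorm
    _ = ‖f‖ := mul_one _

/-- The unit vectors of `c₀` are mapped to a null sequence by every bounded operator of
finite rank. -/
theorem tendsto_apply_e {Q : Type*} [NormedAddCommGroup Q] [NormedSpace ℝ Q]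
    [FiniteDimensional ℝ Q] (q : C₀(ℕ, ℝ) →L[ℝ] Q) :
    Tendsto (fun n => q (e n)) atTop (𝓝 0) := by
  let b := Module.finBasis ℝ Q
  have h : ∀ i, Tendsto (fun n => b.repr (q (e n)) i • b i) atTop (𝓝 0) := fun i => by
    have hs := (summable_abs_apply_e ((b.coord i).toContinuousLinearMap.comp q)).tendsto_atTop_zero
    simpa using ((tendsto_zero_iff_abs_tendsto_zero _).2 hs).smul_const (b i)
  simpa [b.sum_repr] using tendsto_finsetSum Finset.univ fun i _ => h i

theorem topologicalClosure_span_e :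
    (Submodule.span ℝ (Set.range e)).topologicalClosure = ⊤ := by
  refine (Submodule.eq_top_iff').2 fun y => ?_
  refine mem_closure_of_tendsto (b := atTop)
    (f := fun N => ∑ k ∈ Finset.range N, y k • e k) ?_ (Eventually.of_forall fun N => ?_)
  · rw [Metric.tendsto_atTop]
    intro ε hε
    have hy : Tendsto y atTop (𝓝 0) := by
      have := y.zero_at_infty'
      rwa [Filter.cocompact_eq_cofinite, Nat.cofinite_eq_atTop] at this
    obtain ⟨N, hN⟩ := Metric.tendsto_atTop.1 hy (ε / 2) (half_pos hε)
    refine ⟨N, fun M hM => ?_⟩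
    rw [dist_eq_norm]
    refine (zeroAtInfty_norm_le (half_pos hε).le fun n => ?_).trans_lt (half_lt_self hε)
    rw [ZeroAtInftyContinuousMap.sub_apply, sum_smul_e_apply]
    split_ifs with hn
    · simpa using (half_pos hε).le
    · have := hN n (hM.trans (by simpa using hn))
      simpa [Real.dist_eq] using this.le
  · exact Submodule.sum_mem _ fun k _ =>
      Submodule.smul_mem _ _ (Submodule.subset_span ⟨k, rfl⟩)

/-- The images of the unit vectors of `c₀` under a bounded operator onto a normed space are
fundamental. -/
theorem topologicalClosure_span_apply_e {Y : Type*} [NormedAddCommGroup Y] [NormedSpace ℝ Y]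
    (P : C₀(ℕ, ℝ) →L[ℝ] Y) (hP : Function.Surjective P) :
    (Submodule.span ℝ (Set.range fun n => P (e n))).topologicalClosure = ⊤ := by
  have h := hP.denseRange.topologicalClosure_map_submodule topologicalClosure_span_e
  rw [Submodule.map_span, ← Set.range_comp] at h
  exact h

theorem one_le_norm_of_apply_eq_one {Y : Type*} [NormedAddCommGroup Y] [NormedSpace ℝ Y]
    (g : Y →L[ℝ] ℝ) {y : Y} (hy : ‖y‖ ≤ 1) (hg : g y = 1) : 1 ≤ ‖g‖ := by
  simpa [hg] using g.le_opNorm_of_le hy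

/-- A bounded operator with values in the range of a linear isometry factors through it. -/
theorem exists_continuousLinearMap_lift {E F Y : Type*} [NormedAddCommGroup E] [NormedSpace ℝ E]
    [NormedAddCommGroup F] [NormedSpace ℝ F] [NormedAddCommGroup Y] [NormedSpace ℝ Y]
    (j : Y →ₗᵢ[ℝ] F) (T : E →L[ℝ] F) (h : ∀ y, T y ∈ Set.range j) :
    ∃ P : E →L[ℝ] Y, ∀ y, j (P y) = T y := by
  choose p hp using h
  refine ⟨LinearMap.mkContinuous
    { toFun := p
      map_add' := fun y z => j.injective (by simp [hp])
      map_smul' := fun r y => j.injective (by simp [hp]) } ‖T‖ fun y => ?_, hp⟩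
  change ‖p y‖ ≤ _
  rw [← j.norm_map, hp]
  exact T.le_opNorm y

/-- A normed space isometric to the kernel of a bounded operator from `c₀` onto a
finite-dimensional space admits an Auerbach basis. -/
theorem exists_isAuerbachBasis_of_surjective {Q Y : Type*} [NormedAddCommGroup Q] [NormedSpace ℝ Q]
    [FiniteDimensional ℝ Q] [NormedAddCommGroup Y] [NormedSpace ℝ Y]
    (q : C₀(ℕ, ℝ) →L[ℝ] Q) (hq : Function.Surjective q)
    (j : Y →ₗᵢ[ℝ] C₀(ℕ, ℝ)) (hj : ∀ y, q y = 0 ↔ y ∈ Set.range j) :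
    ∃ (x : ℕ → Y) (g : ℕ → Y →L[ℝ] ℝ), IsAuerbachBasis x g := by
  classical
  obtain ⟨κ, _, c, v, hc, hle⟩ := exists_basis_abs_repr_le_one (fun n => q (e n))
    (tendsto_apply_e q) (by
      rw [← topologicalClosure_span_apply_e q hq]
      exact (Submodule.closed_of_finiteDimensional _).submodule_topologicalClosure_eq.symm)
  let S : C₀(ℕ, ℝ) →L[ℝ] C₀(ℕ, ℝ) :=
    ∑ i, ((c.coord i).toContinuousLinearMap.comp q).smulRight (e (v i))
  have hS : ∀ y, S y = ∑ i, c.repr (q y) i • e (v i) := fun y => by simp [S]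
  have hqS : ∀ y, q (S y) = q y := fun y => by
    rw [hS, map_sum]
    simp only [map_smul, ← hc, c.sum_repr]
  have hSj : ∀ y, S (j y) = 0 := fun y => by
    rw [hS, (hj (j y)).2 ⟨y, rfl⟩]
    simp
  obtain ⟨P, hP⟩ := exists_continuousLinearMap_lift j (ContinuousLinearMap.id ℝ C₀(ℕ, ℝ) - S)
    fun y => (hj _).1 (by simp [hqS])
  replace hP : ∀ y, j (P y) = y - S y := hP
  have hv : Function.Injective v := fun i j h => c.injective (by rw [hc, hc, h])
  have hSv : ∀ i, S (e (v i)) = e (v i) := fun i => by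
    rw [hS, ← hc]
    simp [Finsupp.single_apply]
  have hSoff : ∀ y n, n ∉ Set.range v → S y n = 0 := fun y n hn => by
    rw [hS, zeroAtInfty_sum_apply]
    refine Finset.sum_eq_zero fun i _ => ?_
    have : n ≠ v i := fun h => hn ⟨i, h.symm⟩
    simp [this]
  have hSon : ∀ y i, S y (v i) = c.repr (q y) i := fun y i => by
    rw [hS, zeroAtInfty_sum_apply]
    simp [hv.eq_iff]
  have : Infinite ↥(Set.range v)ᶜ := (Set.finite_range v).infinite_compl.to_subtype
  obtain ⟨σ⟩ : Nonempty (ℕ ≃ ↥(Set.range v)ᶜ) := nonempty_equiv_of_countable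
  have hPoff : ∀ k l, j (P (e (σ l))) (σ k) = if k = l then 1 else 0 := fun k l => by
    rw [hP, ZeroAtInftyContinuousMap.sub_apply, hSoff _ _ (σ k).2, sub_zero, e_apply]
    simp [Subtype.coe_inj]
  have hnorm : ∀ n, ‖P (e (σ n))‖ ≤ 1 := fun n => by
    rw [← j.norm_map]
    refine zeroAtInfty_norm_le zero_le_one fun m => ?_
    by_cases hm : m ∈ Set.range v
    · obtain ⟨i, rfl⟩ := hm
      have hne : v i ≠ σ n := fun h => (σ n).2 ⟨i, h⟩
      rw [hP, ZeroAtInftyContinuousMap.sub_apply, hSon, e_apply, if_neg hne, zero_sub, abs_neg]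
      exact hle _ _
    · obtain ⟨k, hk⟩ := σ.surjective ⟨m, hm⟩
      have hk' : m = σ k := by rw [hk]
      rw [hk', hPoff]
      split_ifs <;> simp
  let g : ℕ → Y →L[ℝ] ℝ := fun n => (coord (σ n)).comp j.toContinuousLinearMap
  have hg : ∀ n y, g n y = j y (σ n) := fun _ _ => rfl
  refine ⟨fun n => P (e (σ n)), g, ?_, ?_, ?_, ?_, ?_, ?_⟩
  · intro k
    rw [hg, hPoff, if_pos rfl]
  · intro k l hkl
    rw [hg, hPoff, if_neg hkl]
  · intro n
    refine le_antisymm (hnorm n) ?_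
    have h := abs_apply_le_norm (j (P (e (σ n)))) (σ n)
    rw [hPoff, j.norm_map] at h
    simpa using h
  · intro n
    refine le_antisymm (ContinuousLinearMap.opNorm_le_bound _ zero_le_one fun y => ?_) ?_
    · rw [one_mul, ← j.norm_map y]
      exact abs_apply_le_norm (j y) (σ n)
    · exact one_le_norm_of_apply_eq_one _ (hnorm n) (by rw [hg, hPoff, if_pos rfl])
  · have hPsurj : Function.Surjective P := fun y =>
      ⟨j y, j.injective (by rw [hP, hSj, sub_zero])⟩
    refine top_le_iff.1 ((topologicalClosure_span_apply_e P hPsurj).ge.trans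
      (Submodule.topologicalClosure_mono (Submodule.span_le.2 ?_)))
    rintro _ ⟨m, rfl⟩
    by_cases hm : m ∈ Set.range v
    · obtain ⟨i, rfl⟩ := hm
      have h0 : P (e (v i)) = 0 := j.injective (by rw [hP, hSv, sub_self, map_zero])
      simp [h0]
    · obtain ⟨k, hk⟩ := σ.surjective ⟨m, hm⟩
      exact Submodule.subset_span ⟨k, by simp [hk]⟩
  · intro y hy
    have hy' : ∀ n, n ∉ Set.range v → j y n = 0 := fun n hn => by
      obtain ⟨k, hk⟩ := σ.surjective ⟨n, hn⟩
      simpa [hg, hk] using hy k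
    have hsum : j y = ∑ i, j y (v i) • e (v i) := by
      ext n
      rw [zeroAtInfty_sum_apply]
      by_cases hn : n ∈ Set.range v
      · obtain ⟨i, rfl⟩ := hn
        simp [hv.eq_iff]
      · rw [hy' n hn, Finset.sum_eq_zero]
        intro i _
        have : n ≠ v i := fun h => hn ⟨i, h.symm⟩
        simp [this]
    have hS' : S (j y) = j y := by
      conv_lhs => rw [hsum]
      conv_rhs => rw [hsum]
      simp only [map_sum, map_smul, hSv]
    exact j.injective (by rw [← hS', hSj, map_zero])

/-- Every closed subspace of `c₀` of finite codimension admits an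
Auerbach basis. -/
theorem stmt8 (X : Submodule ℝ C₀(ℕ, ℝ)) (hX : IsClosed (X : Set C₀(ℕ, ℝ)))
    (hcodim : FiniteDimensional ℝ (C₀(ℕ, ℝ) ⧸ X)) :
    ∃ (x : ℕ → X) (g : ℕ → X →L[ℝ] ℝ), IsAuerbachBasis x g := by
  have := hX
  exact exists_isAuerbachBasis_of_surjective (Q := C₀(ℕ, ℝ) ⧸ X) (Y := X) X.mkQL
    X.mkQ_surjective X.subtypeₗᵢ fun _ => by simp
end

section
/- In the space c of convergent real sequences, define x₀ ≡ (1,1,1,...), x₀* = Σ_{k≥1} 2^{-k} δ_k, and for j ≥ 1: xⱼ = -e_j + Σ_{k>j} e_k (the sequence that is 0 on coordinates < j, equals -1 at coordinate j, and 1 at coordinates > j), and xⱼ* = -δ_j/2 + Σ_{k>j} 2^{j-k-1} δ_k. Then ‖xⱼ‖ = ‖xⱼ*‖ = 1 for all j ≥ 0 and (xⱼ; xⱼ*)_{j≥0} is biorthogonal. -/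
open scoped ENNReal
set_option synthInstance.maxHeartbeats 1000000
set_option maxHeartbeats 1000000

/-- The space of `X`-valued convergent sequences, as a subspace of `ℓ^∞(X)` (with the
sup norm). -/
noncomputable def cSubX (X : Type*) [NormedAddCommGroup X] [NormedSpace ℝ X] :
    Submodule ℝ (lp (fun _ : ℕ => X) ∞) where
  carrier := {y | ∃ L : X, Filter.Tendsto (fun n => y n) Filter.atTop (nhds L)}
  zero_mem' := ⟨0, by simp⟩
  add_mem' := by
    rintro y z ⟨L1, h1⟩ ⟨L2, h2⟩
    refine ⟨L1 + L2, ?_⟩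
    have := h1.add h2
    simpa [lp.coeFn_add] using this
  smul_mem' := by
    rintro c y ⟨L, h⟩
    refine ⟨c • L, ?_⟩
    have := h.const_smul c
    simpa [lp.coeFn_smul] using this

/-- The space `c` of convergent real sequences with the sup norm. -/
noncomputable abbrev cSub : Submodule ℝ (lp (fun _ : ℕ => ℝ) ∞) := cSubX ℝ

/-- The coordinate functional `δ_k : y ↦ y_k` on `c`. -/
noncomputable def cCoord (k : ℕ) : cSub →L[ℝ] ℝ :=
  LinearMap.mkContinuous
    { toFun := fun y => (y : lp (fun _ : ℕ => ℝ) ∞) k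
      map_add' := by intro y z; simp
      map_smul' := by intro c y; simp }
    1
    (fun y => by
      rw [one_mul]
      exact lp.norm_apply_le_norm ENNReal.top_ne_zero (y : lp (fun _ : ℕ => ℝ) ∞) k)

/-- `x_j`: for `j = 0` the constant sequence `1`; for `j ≥ 1` the sequence which is `0` on
(paper, `1`-based) coordinates `< j`, `-1` at coordinate `j` and `1` at coordinates `> j`.
Entry `k` of the underlying function is the paper's coordinate `k + 1`. -/
noncomputable def cVec (j : ℕ) : cSub :=
  ⟨⟨fun k => if k + 1 < j then 0 else if k + 1 = j then -1 else 1, by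
      apply memℓp_infty
      refine ⟨1, ?_⟩
      rintro r ⟨k, rfl⟩
      dsimp only
      split_ifs <;> simp⟩,
   ⟨1, by
      refine Filter.Tendsto.congr' ?_ tendsto_const_nhds
      filter_upwards [Filter.eventually_ge_atTop j] with k hk
      have h1 : ¬ (k + 1 < j) := by omega
      have h2 : ¬ (k + 1 = j) := by omega
      simp [h1, h2]⟩⟩

/-- `x_j^*`: `x_0^* = ∑_{k ≥ 1} 2^{-k} δ_k`, and for `j ≥ 1`,
`x_j^* = -δ_j/2 + ∑_{k > j} 2^{j-k-1} δ_k` (again with the `1`-based coordinate `k`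
corresponding to entry `k - 1` of the underlying function, so that `δ` of paper
coordinate `k` is `cCoord (k-1)`). -/
noncomputable def cVecStar (j : ℕ) : cSub →L[ℝ] ℝ :=
  if j = 0 then ∑' k : ℕ, ((1 : ℝ) / 2) ^ (k + 1) • cCoord k
  else (-(1 / 2 : ℝ)) • cCoord (j - 1) + ∑' i : ℕ, ((1 : ℝ) / 2) ^ (i + 2) • cCoord (j + i)

lemma cVec_apply (j k : ℕ) :
    (cVec j : lp (fun _ : ℕ => ℝ) ∞) k = if k + 1 < j then 0 else if k + 1 = j then -1 else 1 :=
  rfl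

lemma norm_cCoord_le (k : ℕ) : ‖cCoord k‖ ≤ 1 :=
  LinearMap.mkContinuous_norm_le _ zero_le_one _

lemma norm_cVec (j : ℕ) : ‖cVec j‖ = 1 := by
  apply le_antisymm
  · refine lp.norm_le_of_forall_le (f := (cVec j : lp (fun _ : ℕ => ℝ) ∞)) zero_le_one fun k => ?_
    rw [cVec_apply]
    split_ifs <;> simp
  · have h := lp.norm_apply_le_norm ENNReal.top_ne_zero (cVec j : lp (fun _ : ℕ => ℝ) ∞) j
    rw [cVec_apply, if_neg (by omega), if_neg (by omega), norm_one] at h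
    exact h

lemma hasSum_half_pow_add (n : ℕ) :
    HasSum (fun i : ℕ => ((1 : ℝ) / 2) ^ (i + n)) (2 * (1 / 2) ^ n) := by
  simpa only [pow_add] using hasSum_geometric_two.mul_right ((1 / 2 : ℝ) ^ n)

lemma tsum_half_pow_mul_eq_zero {f : ℕ → ℝ} {d : ℕ} (hlt : ∀ i < d, f i = 0) (heq : f d = -1)
    (hgt : ∀ i, d < i → f i = 1) (n : ℕ) : ∑' i : ℕ, ((1 : ℝ) / 2) ^ (i + n) * f i = 0 := by
  have hz : ∑ i ∈ Finset.range d, ((1 : ℝ) / 2) ^ (i + n) * f i = 0 :=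
    Finset.sum_eq_zero fun i hi => by rw [hlt i (Finset.mem_range.mp hi), mul_zero]
  have ht : HasSum (fun i : ℕ => ((1 : ℝ) / 2) ^ (i + (d + 1) + n) * f (i + (d + 1)))
      (2 * (1 / 2) ^ (d + 1 + n)) := by
    convert hasSum_half_pow_add (d + 1 + n) using 2 with i
    rw [hgt _ (by omega), mul_one, add_assoc]
  rw [((hasSum_nat_add_iff (d + 1)
    (f := fun i : ℕ => ((1 : ℝ) / 2) ^ (i + n) * f i)).mp ht).tsum_eq, Finset.sum_range_succ, hz,
    heq]
  ring

section DualUnitBall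

variable {E : Type*} [NormedAddCommGroup E] [NormedSpace ℝ E] {φ : ℕ → E →L[ℝ] ℝ}

lemma norm_half_pow_smul_le (hφ : ∀ k, ‖φ k‖ ≤ 1) (n i : ℕ) :
    ‖((1 : ℝ) / 2) ^ (i + n) • φ i‖ ≤ (1 / 2) ^ (i + n) := by
  rw [norm_smul, Real.norm_of_nonneg (by positivity)]
  exact mul_le_of_le_one_right (by positivity) (hφ i)

lemma norm_tsum_half_pow_smul_le (hφ : ∀ k, ‖φ k‖ ≤ 1) (n : ℕ) :
    ‖∑' i : ℕ, ((1 : ℝ) / 2) ^ (i + n) • φ i‖ ≤ 2 * (1 / 2) ^ n :=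
  tsum_of_norm_bounded (hasSum_half_pow_add n) (norm_half_pow_smul_le hφ n)

lemma tsum_half_pow_smul_apply (hφ : ∀ k, ‖φ k‖ ≤ 1) (n : ℕ) (y : E) :
    (∑' i : ℕ, ((1 : ℝ) / 2) ^ (i + n) • φ i) y = ∑' i : ℕ, ((1 : ℝ) / 2) ^ (i + n) * φ i y :=
  (ContinuousLinearMap.apply ℝ ℝ y).map_tsum
    (.of_norm_bounded (hasSum_half_pow_add n).summable (norm_half_pow_smul_le hφ n))

lemma norm_neg_half_smul_add_le {f g : E →L[ℝ] ℝ} (hf : ‖f‖ ≤ 1) (hg : ‖g‖ ≤ 1 / 2) :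
    ‖(-(1 / 2 : ℝ)) • f + g‖ ≤ 1 := by
  have h : ‖(-(1 / 2 : ℝ)) • f‖ ≤ 1 / 2 := by
    rw [norm_smul, norm_neg, Real.norm_of_nonneg (by norm_num)]
    exact mul_le_of_le_one_right (by norm_num) hf
  linarith [norm_add_le ((-(1 / 2 : ℝ)) • f) g]

lemma one_le_norm_of_apply_eq_one_s9 {f : E →L[ℝ] ℝ} {x : E} (hx : ‖x‖ = 1) (hf : f x = 1) :
    1 ≤ ‖f‖ := by
  simpa [hx, hf] using f.le_opNorm x

end DualUnitBall

lemma tsum_half_pow_smul_cCoord_apply (n m : ℕ) (y : cSub) :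
    (∑' i : ℕ, ((1 : ℝ) / 2) ^ (i + n) • cCoord (m + i)) y =
      ∑' i : ℕ, ((1 : ℝ) / 2) ^ (i + n) * (y : lp (fun _ : ℕ => ℝ) ∞) (m + i) :=
  tsum_half_pow_smul_apply (fun i => norm_cCoord_le (m + i)) n y

/-- On `cVec j` with `j ≤ m`, the shifted geometric series only sees the constant tail. -/
lemma tsum_half_pow_smul_cCoord_cVec_of_le (n : ℕ) {m j : ℕ} (h : j ≤ m) :
    (∑' i : ℕ, ((1 : ℝ) / 2) ^ (i + n) • cCoord (m + i)) (cVec j) = 2 * (1 / 2) ^ n := by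
  rw [tsum_half_pow_smul_cCoord_apply, ← (hasSum_half_pow_add n).tsum_eq]
  refine tsum_congr fun i => ?_
  rw [cVec_apply, if_neg (by omega), if_neg (by omega), mul_one]

/-- On `cVec j` with `m < j`, the entry `-1` cancels the tail of the geometric series. -/
lemma tsum_half_pow_smul_cCoord_cVec_of_lt (n : ℕ) {m j : ℕ} (h : m < j) :
    (∑' i : ℕ, ((1 : ℝ) / 2) ^ (i + n) • cCoord (m + i)) (cVec j) = 0 := by
  rw [tsum_half_pow_smul_cCoord_apply]
  refine tsum_half_pow_mul_eq_zero (d := j - m - 1) (fun i hi => ?_) ?_ (fun i hi => ?_) n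
  · rw [cVec_apply, if_pos (by omega)]
  · rw [cVec_apply, if_neg (by omega), if_pos (by omega)]
  · rw [cVec_apply, if_neg (by omega), if_neg (by omega)]

lemma cVecStar_zero : cVecStar 0 = ∑' i : ℕ, ((1 : ℝ) / 2) ^ (i + 1) • cCoord (0 + i) := by
  simp only [cVecStar, if_true, zero_add]

lemma cVecStar_of_ne_zero {k : ℕ} (hk : k ≠ 0) :
    cVecStar k = (-(1 / 2 : ℝ)) • cCoord (k - 1) +
      ∑' i : ℕ, ((1 : ℝ) / 2) ^ (i + 2) • cCoord (k + i) :=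
  if_neg hk

lemma cVecStar_of_ne_zero_apply {k : ℕ} (hk : k ≠ 0) (y : cSub) :
    cVecStar k y = -(1 / 2 : ℝ) * (y : lp (fun _ : ℕ => ℝ) ∞) (k - 1) +
      (∑' i : ℕ, ((1 : ℝ) / 2) ^ (i + 2) • cCoord (k + i)) y := by
  rw [cVecStar_of_ne_zero hk]
  rfl

lemma norm_cVecStar_le (k : ℕ) : ‖cVecStar k‖ ≤ 1 := by
  rcases eq_or_ne k 0 with rfl | hk
  · rw [cVecStar_zero]
    exact (norm_tsum_half_pow_smul_le (fun i => norm_cCoord_le (0 + i)) 1).trans (by norm_num)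
  · rw [cVecStar_of_ne_zero hk]
    exact norm_neg_half_smul_add_le (norm_cCoord_le _)
      ((norm_tsum_half_pow_smul_le (fun i => norm_cCoord_le (k + i)) 2).trans (by norm_num))

lemma cVecStar_cVec_self (j : ℕ) : cVecStar j (cVec j) = 1 := by
  rcases eq_or_ne j 0 with rfl | hj
  · rw [cVecStar_zero, tsum_half_pow_smul_cCoord_cVec_of_le 1 le_rfl]
    norm_num
  · rw [cVecStar_of_ne_zero_apply hj, tsum_half_pow_smul_cCoord_cVec_of_le 2 le_rfl, cVec_apply,
      if_neg (by omega), if_pos (by omega)]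
    norm_num

lemma cVecStar_cVec_of_ne {k j : ℕ} (h : k ≠ j) : cVecStar k (cVec j) = 0 := by
  rcases eq_or_ne k 0 with rfl | hk
  · rw [cVecStar_zero, tsum_half_pow_smul_cCoord_cVec_of_lt 1 (by omega)]
  · rw [cVecStar_of_ne_zero_apply hk, cVec_apply]
    rcases h.lt_or_gt with hlt | hgt
    · rw [tsum_half_pow_smul_cCoord_cVec_of_lt 2 hlt, if_pos (by omega)]
      norm_num
    · rw [tsum_half_pow_smul_cCoord_cVec_of_le 2 hgt.le, if_neg (by omega), if_neg (by omega)]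
      norm_num

lemma norm_cVecStar (j : ℕ) : ‖cVecStar j‖ = 1 :=
  (norm_cVecStar_le j).antisymm (one_le_norm_of_apply_eq_one_s9 (norm_cVec j) (cVecStar_cVec_self j))

/-- The system `(xⱼ; xⱼ^*)_{j ≥ 0}` in `c` (with `x₀ ≡ 1`,
`x₀^* = ∑_{k≥1} 2^{-k} δ_k`, and for `j ≥ 1`, `xⱼ = -eⱼ + ∑_{k>j} e_k`,
`xⱼ^* = -δⱼ/2 + ∑_{k>j} 2^{j-k-1} δ_k`) consists of norm-one vectors and norm-one
functionals and is biorthogonal. -/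
theorem stmt9 :
    (∀ j, ‖cVec j‖ = 1) ∧ (∀ j, ‖cVecStar j‖ = 1) ∧
    (∀ j, cVecStar j (cVec j) = 1) ∧
    (∀ k j, k ≠ j → cVecStar k (cVec j) = 0) := by
  exact ⟨norm_cVec, norm_cVecStar, cVecStar_cVec_self, fun _ _ => cVecStar_cVec_of_ne⟩
end

section
/- Let K be a countable compact metric space with exactly finitely many accumulation points. Then C(K), the Banach space of continuous real-valued functions on K with sup norm, admits an Auerbach basis. -/
/-- A biorthogonal, fundamental and total system in the unit balls is an Auerbach basis. -/
theorem IsAuerbachBasis.of_norm_le_one {X : Type*} [NormedAddCommGroup X] [NormedSpace ℝ X]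
    {ι : Type*} {x : ι → X} {f : ι → X →L[ℝ] ℝ}
    (biorth_eq : ∀ k, f k (x k) = 1) (biorth_ne : ∀ k j, k ≠ j → f k (x j) = 0)
    (hx : ∀ n, ‖x n‖ ≤ 1) (hf : ∀ n, ‖f n‖ ≤ 1)
    (fundamental : (Submodule.span ℝ (Set.range x)).topologicalClosure = ⊤)
    (total : ∀ y, (∀ n, f n y = 0) → y = 0) : IsAuerbachBasis x f := by
  have key : ∀ n, 1 ≤ ‖f n‖ * ‖x n‖ := fun n => by
    simpa [biorth_eq n] using (f n).le_opNorm (x n)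
  refine ⟨biorth_eq, biorth_ne, fun n => ?_, fun n => ?_, fundamental, total⟩
  · nlinarith [key n, hx n, hf n, norm_nonneg (x n), norm_nonneg (f n)]
  · nlinarith [key n, hx n, hf n, norm_nonneg (x n), norm_nonneg (f n)]

/-- The geometric averages of a function along the tails of a sequence of points. -/
theorem exists_geometric_averages {K : Type*} [TopologicalSpace K] [CompactSpace K] (p : ℕ → K) :
    ∃ T : ℕ → (C(K, ℝ) →L[ℝ] ℝ), (∀ n, ‖T n‖ ≤ 1) ∧
      (∀ n y, T n y = (y (p n) + T (n + 1) y) / 2) ∧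
      ∀ n y c, (∀ k, n ≤ k → y (p k) = c) → T n y = c := by
  have hbd : ∀ n (y : C(K, ℝ)) k, ‖y (p (n + k)) / 2 / 2 ^ k‖ ≤ ‖y‖ / 2 / 2 ^ k := by
    intro n y k
    rw [norm_div, norm_div, norm_pow, Real.norm_ofNat]
    gcongr
    exact y.norm_coe_le_norm _
  have hsum : ∀ n (y : C(K, ℝ)), Summable fun k => y (p (n + k)) / 2 / 2 ^ k := fun n y =>
    Summable.of_norm_bounded (hasSum_geometric_two' ‖y‖).summable (hbd n y)
  let L : ℕ → C(K, ℝ) →ₗ[ℝ] ℝ := fun n =>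
    { toFun := fun y => ∑' k, y (p (n + k)) / 2 / 2 ^ k
      map_add' := fun y z => by
        rw [← (hsum n y).tsum_add (hsum n z)]
        exact tsum_congr fun k => by simp only [ContinuousMap.add_apply]; ring
      map_smul' := fun c y => by
        simp only [RingHom.id_apply, smul_eq_mul]
        rw [← tsum_mul_left]
        exact tsum_congr fun k => by simp only [ContinuousMap.smul_apply, smul_eq_mul]; ring }
  have hL : ∀ n y, ‖L n y‖ ≤ 1 * ‖y‖ := fun n y => by
    rw [one_mul]
    exact tsum_of_norm_bounded (hasSum_geometric_two' ‖y‖) (hbd n y)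
  refine ⟨fun n => (L n).mkContinuous 1 (hL n),
    fun n => LinearMap.mkContinuous_norm_le _ zero_le_one _, fun n y => ?_, fun n y c h => ?_⟩
  · change ∑' k, y (p (n + k)) / 2 / 2 ^ k
      = (y (p n) + ∑' k, y (p (n + 1 + k)) / 2 / 2 ^ k) / 2
    rw [(hsum n y).tsum_eq_zero_add, add_div, ← tsum_div_const]
    congr 1
    · simp
    · refine tsum_congr fun k => ?_
      rw [show n + (k + 1) = n + 1 + k by ring, pow_succ]
      ring
  · change ∑' k, y (p (n + k)) / 2 / 2 ^ k = c
    rw [← (hasSum_geometric_two' c).tsum_eq]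
    exact tsum_congr fun k => by rw [h _ (Nat.le_add_right n k)]

/-- A compact space that splits into finitely many convergent sequences `p a`, with limits `q a`
and clopen tails `U a n`, has an Auerbach basis in its space of continuous functions. -/
theorem exists_isAuerbachBasis_of_sequences {K A : Type} [TopologicalSpace K] [CompactSpace K]
    [Fintype A] (p : A → ℕ → K) (q : A → K) (U : A → ℕ → Set K)
    (hU : ∀ a n, IsClopen (U a n)) (hanti : ∀ a, Antitone (U a))
    (hp : ∀ a n, p a n ∈ U a n) (hp' : ∀ a n, p a n ∉ U a (n + 1))
    (hstep : ∀ a n, ∀ x ∈ U a n, x ≠ p a n → x ∈ U a (n + 1))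
    (hdisj : ∀ a b x, x ∈ U a 0 → x ∈ U b 0 → a = b) (hcov : ∀ x, ∃ a, x ∈ U a 0)
    (hpts : ∀ x, (∃ a, x = q a) ∨ ∃ a n, x = p a n)
    (hlim : ∀ a, ∀ V ∈ nhds (q a), ∃ n, U a n ⊆ V) :
    ∃ (ι : Type) (x : ι → C(K, ℝ)) (f : ι → C(K, ℝ) →L[ℝ] ℝ), IsAuerbachBasis x f := by
  classical
  choose T hT1 hTrec hTconst using fun a => exists_geometric_averages (p a)
  let e : A → ℕ → C(K, ℝ) := fun a n =>
    ⟨(U a n).indicator 1, (hU a n).continuous_indicator continuous_const⟩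
  have e1 : ∀ {a n x}, x ∈ U a n → e a n x = 1 := fun h => Set.indicator_of_mem h _
  have e0 : ∀ {a n x}, x ∉ U a n → e a n x = 0 := fun h => Set.indicator_of_notMem h _
  have hTne : ∀ a b n m, a ≠ b → T a n (e b m) = 0 := fun a b n m hab =>
    hTconst a n _ _ fun k _ => e0 fun h =>
      hab (hdisj a b _ (hanti a (Nat.zero_le k) (hp a k)) (hanti b (Nat.zero_le m) h))
  have hTone : ∀ a n m, m ≤ n → T a n (e a m) = 1 := fun a n m h =>
    hTconst a n _ _ fun k hk => e1 (hanti a (h.trans hk) (hp a k))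
  have hTpow : ∀ a d n, T a n (e a (n + d)) = (1 / 2) ^ d := by
    intro a d
    induction d with
    | zero => intro n; simpa using hTone a n n le_rfl
    | succ d ih =>
      intro n
      rw [hTrec, e0 fun h => hp' a n (hanti a (by omega) h),
        show n + (d + 1) = n + 1 + d by ring, ih (n + 1)]
      ring
  let x : A × Option ℕ → C(K, ℝ) := fun i =>
    i.2.elim (e i.1 0) fun n => e i.1 n - (2 : ℝ) • e i.1 (n + 1)
  let f : A × Option ℕ → C(K, ℝ) →L[ℝ] ℝ := fun i =>
    i.2.elim (T i.1 0) fun n => T i.1 n - T i.1 (n + 1)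
  have hTx : ∀ a n m, T a n (x (a, some m)) = if m < n then -1 else 0 := by
    intro a n m
    change T a n (e a m - (2 : ℝ) • e a (m + 1)) = _
    rw [map_sub, map_smul, smul_eq_mul]
    split_ifs with h
    · rw [hTone a n m h.le, hTone a n (m + 1) h]; norm_num
    · obtain ⟨d, rfl⟩ := Nat.exists_eq_add_of_le (not_lt.1 h)
      rw [hTpow, add_assoc, hTpow]; ring
  have hTx' : ∀ a b n i, a ≠ b → T a n (x (b, i)) = 0 := by
    rintro a b n (_ | m) hab
    · exact hTne _ _ _ _ hab
    · change T a n (e b m - (2 : ℝ) • e b (m + 1)) = _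
      rw [map_sub, map_smul, hTne _ _ _ _ hab, hTne _ _ _ _ hab]; simp
  have hbi : ∀ i j, f i (x j) = if i = j then 1 else 0 := by
    rintro ⟨a, i⟩ ⟨b, j⟩
    by_cases hab : a = b
    · subst hab
      rcases i with _ | n <;> rcases j with _ | m
      · rw [if_pos rfl]
        exact hTone a 0 0 le_rfl
      · change T a 0 (x (a, some m)) = _
        simp [hTx]
      · change T a n (e a 0) - T a (n + 1) (e a 0) = _
        simp [hTone]
      · change T a n (x (a, some m)) - T a (n + 1) (x (a, some m)) = _
        rw [hTx, hTx]
        simp only [Prod.mk.injEq, true_and, Option.some.injEq]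
        split_ifs <;> first | omega | norm_num
    · rw [if_neg fun h => hab (congrArg Prod.fst h)]
      rcases i with _ | n
      · exact hTx' _ _ _ _ hab
      · change T a n (x (b, j)) - T a (n + 1) (x (b, j)) = _
        rw [hTx' _ _ _ _ hab, hTx' _ _ _ _ hab, sub_zero]
  have hx : ∀ i, ‖x i‖ ≤ 1 := by
    rintro ⟨a, _ | n⟩ <;> refine (ContinuousMap.norm_le _ zero_le_one).2 fun z => ?_
    · change ‖e a 0 z‖ ≤ 1
      by_cases h : z ∈ U a 0
      · simp [e1 h]
      · simp [e0 h]
    · change ‖e a n z - 2 * e a (n + 1) z‖ ≤ 1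
      by_cases h : z ∈ U a (n + 1)
      · rw [e1 h, e1 (hanti a n.le_succ h)]; norm_num
      · rw [e0 h]
        by_cases h' : z ∈ U a n
        · simp [e1 h']
        · simp [e0 h']
  have hf : ∀ i, ‖f i‖ ≤ 1 := by
    rintro ⟨a, _ | n⟩
    · exact hT1 a 0
    · refine ContinuousLinearMap.opNorm_le_bound _ zero_le_one fun y => ?_
      change ‖T a n y - T a (n + 1) y‖ ≤ 1 * ‖y‖
      have h1 := y.norm_coe_le_norm (p a n)
      have h2 := (T a (n + 1)).le_of_opNorm_le (hT1 a (n + 1)) y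
      rw [hTrec]
      rw [Real.norm_eq_abs, abs_le] at *
      constructor <;> linarith [h1.1, h1.2, h2.1, h2.2]
  refine ⟨A × Option ℕ, x, f, IsAuerbachBasis.of_norm_le_one (fun k => by simp [hbi])
    (fun k j h => by simp [hbi, h]) hx hf ?_ fun y hy => ?_⟩
  · set S := Submodule.span ℝ (Set.range x)
    have hxS : ∀ i, x i ∈ S := fun i => Submodule.subset_span ⟨i, rfl⟩
    have heS : ∀ a n, e a n ∈ S := by
      intro a n
      induction n with
      | zero => exact hxS (a, none)
      | succ n ih =>
        have h : e a (n + 1) = (1 / 2 : ℝ) • (e a n - x (a, some n)) := by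
          change _ = (1 / 2 : ℝ) • (e a n - (e a n - (2 : ℝ) • e a (n + 1)))
          rw [sub_sub_cancel, smul_smul]
          norm_num
        rw [h]
        exact S.smul_mem _ (S.sub_mem ih (hxS _))
    refine eq_top_iff.2 fun y _ => ?_
    have hdiff : ∀ a n, y * e a 0 - y * e a n ∈ S := by
      intro a n
      induction n with
      | zero => simp
      | succ n ih =>
        have h : y * e a 0 - y * e a (n + 1)
            = (y * e a 0 - y * e a n) + y (p a n) • (e a n - e a (n + 1)) := by
          ext z
          change y z * e a 0 z - y z * e a (n + 1) z
            = (y z * e a 0 z - y z * e a n z) + y (p a n) * (e a n z - e a (n + 1) z)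
          by_cases hz : z = p a n
          · subst hz; ring
          · have : e a n z = e a (n + 1) z := by
              by_cases h : z ∈ U a n
              · rw [e1 h, e1 (hstep a n z h hz)]
              · rw [e0 h, e0 fun h' => h (hanti a n.le_succ h')]
            rw [this]; ring
        rw [h]
        exact S.add_mem ih (S.smul_mem _ (S.sub_mem (heS a n) (heS a (n + 1))))
    have hloc : ∀ a, y * e a 0 ∈ S.topologicalClosure := by
      intro a
      rw [← SetLike.mem_coe, Submodule.topologicalClosure_coe, Metric.mem_closure_iff]
      intro ε hε
      obtain ⟨n, hn⟩ := hlim a _ (y.continuous.continuousAt.preimage_mem_nhds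
        (Metric.closedBall_mem_nhds (y (q a)) (half_pos hε)))
      refine ⟨(y * e a 0 - y * e a n) + y (q a) • e a n,
        S.add_mem (hdiff a n) (S.smul_mem _ (heS a n)), ?_⟩
      rw [dist_eq_norm]
      refine lt_of_le_of_lt ((ContinuousMap.norm_le _ (half_pos hε).le).2 fun z => ?_)
        (half_lt_self hε)
      change ‖y z * e a 0 z - (y z * e a 0 z - y z * e a n z + y (q a) * e a n z)‖ ≤ ε / 2
      by_cases h : z ∈ U a n
      · have := hn h
        rw [Set.mem_preimage, Metric.mem_closedBall, dist_eq_norm] at this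
        rw [e1 h]
        rwa [show y z * e a 0 z - (y z * e a 0 z - y z * 1 + y (q a) * 1) = y z - y (q a) by ring]
      · rw [e0 h]
        simpa using (half_pos hε).le
    have hone : y = ∑ a, y * e a 0 := by
      rw [← Finset.mul_sum]
      ext z
      obtain ⟨a, ha⟩ := hcov z
      rw [ContinuousMap.mul_apply, ContinuousMap.sum_apply, Finset.sum_eq_single a, e1 ha, mul_one]
      · exact fun b _ hb => e0 fun h => hb (hdisj b a z h ha)
      · simp
    rw [hone]
    exact Submodule.sum_mem _ fun a _ => hloc a
  · have hT0 : ∀ a n, T a n y = 0 := by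
      intro a n
      induction n with
      | zero => exact hy (a, none)
      | succ n ih =>
        have h : T a n y - T a (n + 1) y = 0 := hy (a, some n)
        linarith
    have hyp : ∀ a n, y (p a n) = 0 := fun a n => by
      have := hTrec a n y
      rw [hT0, hT0] at this
      linarith
    ext z
    rcases hpts z with ⟨a, rfl⟩ | ⟨a, n, rfl⟩
    · by_contra h
      obtain ⟨n, hn⟩ := hlim a _ (y.continuous.continuousAt.preimage_mem_nhds
        (isOpen_ne.mem_nhds h))
      exact hn (hp a n) (hyp a n)
    · exact hyp a n

theorem exists_isAuerbachBasis_of_finite (K : Type) [TopologicalSpace K] [DiscreteTopology K]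
    [Finite K] :
    ∃ (ι : Type) (x : ι → C(K, ℝ)) (f : ι → C(K, ℝ) →L[ℝ] ℝ), IsAuerbachBasis x f := by
  classical
  have := Fintype.ofFinite K
  let x : K → C(K, ℝ) := fun k => ⟨Pi.single k 1, continuous_of_discreteTopology⟩
  refine ⟨K, x, fun k => ContinuousMap.evalCLM ℝ k,
    IsAuerbachBasis.of_norm_le_one (fun k => ?_) (fun k j h => ?_) (fun k => ?_) (fun k => ?_) ?_
      fun y hy => ContinuousMap.ext hy⟩
  · exact Pi.single_eq_same k 1
  · exact Pi.single_eq_of_ne h 1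
  · refine (ContinuousMap.norm_le _ zero_le_one).2 fun z => ?_
    change ‖(Pi.single k 1 : K → ℝ) z‖ ≤ 1
    rw [Pi.single_apply]
    split_ifs <;> simp
  · refine ContinuousLinearMap.opNorm_le_bound _ zero_le_one fun y => ?_
    rw [one_mul]
    exact y.norm_coe_le_norm k
  · refine eq_top_iff.2 fun y _ => Submodule.le_topologicalClosure _ ?_
    have h : y = ∑ k, y k • x k := by
      ext z
      rw [ContinuousMap.sum_apply, Finset.sum_eq_single z]
      · change y z = y z * (Pi.single z 1 : K → ℝ) z
        simp
      · intro b _ hb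
        change y b * (Pi.single b 1 : K → ℝ) z = 0
        simp [hb.symm]
      · simp
    rw [h]
    exact Submodule.sum_mem _ fun k _ => Submodule.smul_mem _ _ (Submodule.subset_span ⟨k, rfl⟩)

/-- If all points outside a finite nonempty set `A` are isolated, then the space retracts onto `A`
with clopen fibres. -/
theorem exists_retraction_onto_accPts {K : Type*} [TopologicalSpace K] [T2Space K] {A : Set K}
    (hA : A.Finite) (hne : A.Nonempty) (hiso : ∀ x ∉ A, IsOpen {x}) :
    ∃ π : K → K, (∀ x, π x ∈ A) ∧ (∀ a ∈ A, π a = a) ∧ ∀ a, IsClopen (π ⁻¹' {a}) := by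
  classical
  obtain ⟨W, hW, hWd⟩ := hA.t2_separation
  obtain ⟨a₀, ha₀⟩ := hne
  let π : K → K := fun x => if h : ∃ a ∈ A, x ∈ W a then h.choose else a₀
  have hπ : ∀ a ∈ A, ∀ x ∈ W a, π x = a := by
    intro a ha x hx
    have h : ∃ a ∈ A, x ∈ W a := ⟨a, ha, hx⟩
    have hval : π x = h.choose := dif_pos h
    rw [hval]
    by_contra hcon
    exact Set.disjoint_left.1 (hWd h.choose_spec.1 ha hcon) h.choose_spec.2 hx
  have hloc : ∀ s : Set K, IsOpen (π ⁻¹' s) := by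
    intro s
    refine isOpen_iff_mem_nhds.2 fun x hx => ?_
    by_cases hxA : x ∈ A
    · refine Filter.mem_of_superset ((hW x).2.mem_nhds (hW x).1) fun z hz => ?_
      rw [Set.mem_preimage, hπ x hxA x (hW x).1] at hx
      rwa [Set.mem_preimage, hπ x hxA z hz]
    · exact Filter.mem_of_superset ((hiso x hxA).mem_nhds rfl) (by simpa using hx)
  refine ⟨π, fun x => ?_, fun a ha => hπ a ha a (hW a).1,
    fun a => ⟨⟨by simpa using hloc {a}ᶜ⟩, hloc {a}⟩⟩
  by_cases h : ∃ a ∈ A, x ∈ W a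
  · have hval : π x = h.choose := dif_pos h
    exact hval ▸ h.choose_spec.1
  · have hval : π x = a₀ := dif_neg h
    exact hval ▸ ha₀

/-- If `K` is a countable compact metric space with only finitely many
accumulation points, then `C(K)` (with the sup norm) admits an Auerbach basis. -/
theorem stmt13 (K : Type) [MetricSpace K] [CompactSpace K] [Countable K]
    (hacc : {x : K | AccPt x (Filter.principal (Set.univ : Set K))}.Finite) :
    ∃ (ι : Type) (x : ι → C(K, ℝ)) (f : ι → C(K, ℝ) →L[ℝ] ℝ), IsAuerbachBasis x f := by
  classical
  set A := {x : K | AccPt x (Filter.principal (Set.univ : Set K))} with hAdef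
  have hiso : ∀ x ∉ A, IsOpen {x} := by
    intro x hx
    rw [hAdef, Set.mem_ofPred_eq, accPt_iff_nhds] at hx
    push Not at hx
    obtain ⟨V, hV, hVx⟩ := hx
    refine isOpen_singleton_of_finite_mem_nhds x hV ((Set.finite_singleton x).subset fun z hz => ?_)
    exact hVx z ⟨hz, trivial⟩
  rcases A.eq_empty_or_nonempty with hA | hA
  · have : DiscreteTopology K := discreteTopology_iff_isOpen_singleton.2 fun x =>
      hiso x (hA ▸ Set.notMem_empty x)
    have : Finite K := finite_of_compact_of_discrete
    exact exists_isAuerbachBasis_of_finite K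
  obtain ⟨π, hπA, hπid, hπ⟩ := exists_retraction_onto_accPts hacc hA hiso
  have := hacc.fintype
  have henum : ∀ a : A, Nonempty (ℕ ≃ {x : K // π x = a ∧ x ≠ a}) := by
    intro a
    have : Infinite {x : K // π x = a ∧ x ≠ a} := by
      refine Set.infinite_coe_iff.2 fun hfin => ?_
      have hV : π ⁻¹' {(a : K)} ∈ nhds (a : K) := (hπ a).isOpen.mem_nhds (hπid a a.2)
      obtain ⟨z, hz, hza⟩ := accPt_iff_nhds.1 a.2 _
        (Filter.inter_mem hV (hfin.isClosed.isOpen_compl.mem_nhds fun h => h.2 rfl))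
      exact hz.1.2 ⟨hz.1.1, hza⟩
    infer_instance
  let p : A → ℕ → K := fun a n => (henum a).some n
  have hpπ : ∀ a n, π (p a n) = a := fun a n => ((henum a).some n).2.1
  have hpne : ∀ a n, p a n ≠ a := fun a n => ((henum a).some n).2.2
  have hpinj : ∀ a, Function.Injective (p a) := fun a =>
    Subtype.val_injective.comp (henum a).some.injective
  have hpsurj : ∀ (a : A) x, π x = a → x ≠ a → ∃ n, x = p a n := fun a x h h' =>
    ⟨(henum a).some.symm ⟨x, h, h'⟩, by simp [p]⟩
  have hpA : ∀ a n, p a n ∉ A := fun a n h => hpne a n ((hπid _ h).symm.trans (hpπ a n))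
  let U : A → ℕ → Set K := fun a n => {x | π x = a ∧ ∀ k < n, x ≠ p a k}
  have hU : ∀ a n, IsClopen (U a n) := by
    intro a n
    have h : U a n = π ⁻¹' {(a : K)} ∩ ⋂ k ∈ Set.Iio n, {p a k}ᶜ := by
      ext x; simp [U]
    rw [h]
    exact (hπ a).inter ((Set.finite_Iio n).isClopen_biInter fun k _ =>
      IsClopen.compl ⟨isClosed_singleton, hiso _ (hpA a k)⟩)
  have hanti : ∀ a, Antitone (U a) := fun a m n h x hx => ⟨hx.1, fun k hk => hx.2 k (hk.trans_le h)⟩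
  refine exists_isAuerbachBasis_of_sequences p (fun a => a) U hU hanti
    (fun a n => ⟨hpπ a n, fun k hk h => hk.ne' (hpinj a h)⟩)
    (fun a n h => h.2 n n.lt_succ_self rfl)
    (fun a n x hx hne => ⟨hx.1, fun k hk => ?_⟩)
    (fun a b x ha hb => Subtype.ext (ha.1.symm.trans hb.1))
    (fun x => ⟨⟨π x, hπA x⟩, rfl, fun k hk => absurd hk k.not_lt_zero⟩)
    (fun x => ?_) (fun a V hV => ?_)
  · rcases Nat.lt_succ_iff_lt_or_eq.1 hk with hk | rfl
    · exact hx.2 k hk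
    · exact hne
  · by_cases h : x = π x
    · exact Or.inl ⟨⟨π x, hπA x⟩, h⟩
    · exact Or.inr ⟨⟨π x, hπA x⟩, hpsurj ⟨π x, hπA x⟩ x rfl h⟩
  · refine exists_subset_nhds_of_isCompact (hanti a).directed_ge
      (fun n => (hU a n).isClosed.isCompact) fun x hx => ?_
    rw [Set.mem_iInter] at hx
    have hxa : x = a := by
      by_contra hne
      obtain ⟨n, hn⟩ := hpsurj a x (hx 0).1 hne
      exact (hx (n + 1)).2 n n.lt_succ_self hn
    rwa [hxa]
end
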